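/- Let q, a be complex numbers with |q| < 1 and 1 - a q^n ≠ 0 for all n ≥ 1. Then (aq;q)_∞ · ∑_{n=1}^∞ ( n a^n q^{n^2} ) / ( (q;q)_n (aq;q)_n ) = ∑_{n=1}^∞ ( (-1)^{n-1} a^n q^{n(n+1)/2} ) / (1 - q^n). -/

import Mathlib

/-- The finite q-Pochhammer symbol `(A;q)_n = (1-A)(1-Aq)⋯(1-Aq^{n-1})`. -/
noncomputable def qPoch (q A : ℂ) (n : ℕ) : ℂ := ∏ k ∈ Finset.range n, (1 - A * q ^ k)

/-- The infinite q-Pochhammer symbol `(A;q)_∞ = ∏_{k≥0} (1 - A q^k)`. -/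
noncomputable def qPochInf (q A : ℂ) : ℂ := ∏' k : ℕ, (1 - A * q ^ k)

open Filter Topology
open Finset.HasAntidiagonal (antidiagonal)

theorem one_sub_pow_succ_ne_zero {q : ℂ} (hq : ‖q‖ < 1) (k : ℕ) : 1 - q ^ (k + 1) ≠ 0 := by
  intro h
  have h1 : ‖q ^ (k + 1)‖ = 1 := by rw [← sub_eq_zero.mp h, norm_one]
  rw [norm_pow] at h1
  exact (pow_lt_one₀ (norm_nonneg q) hq k.succ_ne_zero).ne h1

theorem qPoch_succ (q A : ℂ) (n : ℕ) : qPoch q A (n + 1) = qPoch q A n * (1 - A * q ^ n) :=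
  Finset.prod_range_succ _ _

theorem qPoch_self_succ (q : ℂ) (n : ℕ) : qPoch q q (n + 1) = qPoch q q n * (1 - q ^ (n + 1)) := by
  rw [qPoch_succ, pow_succ']

theorem qPoch_self_ne_zero {q : ℂ} (hq : ‖q‖ < 1) (n : ℕ) : qPoch q q n ≠ 0 := by
  refine Finset.prod_ne_zero_iff.mpr fun k _ => ?_
  rw [← pow_succ']
  exact one_sub_pow_succ_ne_zero hq k

/-- The coefficients `(-1)^k q^{k(k-1)/2} / (q;q)_k` of the power series of `(x;q)_∞`. -/
noncomputable def eulerCoeff (q : ℂ) (k : ℕ) : ℂ := (-1) ^ k * q ^ k.choose 2 / qPoch q q k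

theorem eulerCoeff_zero (q : ℂ) : eulerCoeff q 0 = 1 := by simp [eulerCoeff, qPoch]

theorem eulerCoeff_succ_mul {q : ℂ} (hq : ‖q‖ < 1) (k : ℕ) :
    eulerCoeff q (k + 1) * (1 - q ^ (k + 1)) = -q ^ k * eulerCoeff q k := by
  have h1 := one_sub_pow_succ_ne_zero hq k
  have h2 := qPoch_self_ne_zero hq k
  have h3 : (k + 1).choose 2 = k + k.choose 2 := by
    rw [Nat.choose_succ_succ' k 1, Nat.choose_one_right]
  rw [eulerCoeff, eulerCoeff, qPoch_self_succ, h3, pow_add, pow_succ]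
  field_simp
  ring

theorem summable_eulerCoeff_mul_pow {q : ℂ} (hq : ‖q‖ < 1) (x : ℂ) :
    Summable fun k => eulerCoeff q k * x ^ k := by
  have hlim : Tendsto (fun k : ℕ => ‖-q ^ k * x / (1 - q ^ (k + 1))‖) atTop (𝓝 0) := by
    have h0 := tendsto_pow_atTop_nhds_zero_of_norm_lt_one hq
    have h1 : Tendsto (fun k : ℕ => q ^ (k + 1)) atTop (𝓝 0) := (tendsto_add_atTop_iff_nat 1).mpr h0
    have h2 := ((h0.neg.mul_const x).div (h1.const_sub 1) (by simp)).norm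
    simpa using h2
  refine summable_of_ratio_norm_eventually_le (r := 1 / 2) (by norm_num) ?_
  filter_upwards [hlim.eventually (eventually_le_nhds (show (0 : ℝ) < 1 / 2 by norm_num))] with k hk
  have h1 := one_sub_pow_succ_ne_zero hq k
  have h2 : eulerCoeff q (k + 1) * x ^ (k + 1) =
      -q ^ k * x / (1 - q ^ (k + 1)) * (eulerCoeff q k * x ^ k) := by
    rw [eq_div_of_mul_eq h1 (eulerCoeff_succ_mul hq k)]
    ring
  rw [h2, norm_mul]
  gcongr

theorem tsum_eulerCoeff_eq_one_sub_mul {q : ℂ} (hq : ‖q‖ < 1) (x : ℂ) :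
    ∑' k, eulerCoeff q k * x ^ k = (1 - x) * ∑' k, eulerCoeff q k * (x * q) ^ k := by
  have hs := summable_eulerCoeff_mul_pow hq x
  have hs' := summable_eulerCoeff_mul_pow hq (x * q)
  have h : ∑' k, eulerCoeff q k * x ^ k - ∑' k, eulerCoeff q k * (x * q) ^ k
      = -x * ∑' k, eulerCoeff q k * (x * q) ^ k := by
    rw [← hs.tsum_sub hs', (hs.sub hs').tsum_eq_zero_add, ← tsum_mul_left]
    simp only [pow_zero, sub_self, zero_add]
    refine tsum_congr fun k => ?_
    linear_combination x ^ (k + 1) * eulerCoeff_succ_mul hq k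
  linear_combination h

theorem tsum_eulerCoeff_eq_qPoch_mul {q : ℂ} (hq : ‖q‖ < 1) (x : ℂ) (n : ℕ) :
    ∑' k, eulerCoeff q k * x ^ k = qPoch q x n * ∑' k, eulerCoeff q k * (x * q ^ n) ^ k := by
  induction n with
  | zero => simp [qPoch]
  | succ n ih =>
    rw [ih, tsum_eulerCoeff_eq_one_sub_mul hq (x * q ^ n), qPoch_succ, mul_assoc x, ← pow_succ,
      mul_assoc]

/-- Euler's expansion of `(x;q)_∞`. -/
theorem qPochInf_eq_tsum {q : ℂ} (hq : ‖q‖ < 1) (x : ℂ) :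
    qPochInf q x = ∑' k, eulerCoeff q k * x ^ k := by
  have hmul : Multipliable fun k : ℕ => 1 - x * q ^ k := by
    have h : Summable fun k : ℕ => ‖-(x * q ^ k)‖ := by
      simpa [norm_mul] using (summable_geometric_of_lt_one (norm_nonneg q) hq).mul_left ‖x‖
    simpa [sub_eq_add_neg] using multipliable_one_add_of_summable h
  have hprod : Tendsto (fun n => qPoch q x n) atTop (𝓝 (qPochInf q x)) :=
    hmul.hasProd.tendsto_prod_nat
  have hsum : Tendsto (fun n : ℕ => ∑' k, eulerCoeff q k * (x * q ^ n) ^ k) atTop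
      (𝓝 (∑' k, eulerCoeff q k * (0 : ℂ) ^ k)) := by
    refine tendsto_tsum_of_dominated_convergence (summable_eulerCoeff_mul_pow hq x).norm ?_ ?_
    · intro k
      have h := (tendsto_pow_atTop_nhds_zero_of_norm_lt_one hq).const_mul x
      rw [mul_zero] at h
      exact (h.pow k).const_mul _
    · refine Eventually.of_forall fun n k => ?_
      rw [norm_mul, norm_mul, norm_pow, norm_pow, norm_mul, norm_pow]
      gcongr
      exact mul_le_of_le_one_right (norm_nonneg x) (pow_le_one₀ (norm_nonneg q) hq.le)
  have h0 : ∑' k, eulerCoeff q k * (0 : ℂ) ^ k = 1 := by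
    rw [tsum_eq_single 0 fun k hk => by simp [hk]]
    simp [eulerCoeff_zero]
  rw [h0] at hsum
  have h := hprod.mul hsum
  simp only [← tsum_eulerCoeff_eq_qPoch_mul hq, mul_one] at h
  exact tendsto_nhds_unique h tendsto_const_nhds

/-- The `q`-Pascal recurrence for weighted alternating sums of `q`-binomial coefficients. -/
theorem sum_antidiagonal_succ_eulerCoeff {q : ℂ} (hq : ‖q‖ < 1) (w : ℕ → ℂ) (N : ℕ) :
    (∑ p ∈ antidiagonal (N + 1), w p.1 * (eulerCoeff q p.1 / qPoch q q p.2)) *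
        (1 - q ^ (N + 1)) =
      ∑ p ∈ antidiagonal N, w p.1 * (eulerCoeff q p.1 / qPoch q q p.2) -
        q ^ N * ∑ p ∈ antidiagonal N, w (p.1 + 1) * (eulerCoeff q p.1 / qPoch q q p.2) := by
  have hsplit : (∑ p ∈ antidiagonal (N + 1), w p.1 * (eulerCoeff q p.1 / qPoch q q p.2)) *
        (1 - q ^ (N + 1)) =
      ∑ p ∈ antidiagonal (N + 1),
          w p.1 * (eulerCoeff q p.1 / qPoch q q p.2) * (1 - q ^ p.2) +
        ∑ p ∈ antidiagonal (N + 1),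
          w p.1 * (eulerCoeff q p.1 / qPoch q q p.2) * (q ^ p.2 * (1 - q ^ p.1)) := by
    rw [Finset.sum_mul, ← Finset.sum_add_distrib]
    refine Finset.sum_congr rfl fun p hp => ?_
    rw [← Finset.HasAntidiagonal.mem_antidiagonal.mp hp, pow_add]
    ring
  rw [hsplit, Finset.Nat.sum_antidiagonal_succ', Finset.Nat.sum_antidiagonal_succ, Finset.mul_sum,
    sub_eq_add_neg (∑ p ∈ antidiagonal N, _), ← Finset.sum_neg_distrib]
  simp only [pow_zero, sub_self, mul_zero, zero_add]
  congr 1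
  · refine Finset.sum_congr rfl fun p _ => ?_
    have h1 := one_sub_pow_succ_ne_zero hq p.2
    have h2 := qPoch_self_ne_zero hq p.2
    rw [qPoch_self_succ]
    field_simp
  · refine Finset.sum_congr rfl fun p hp => ?_
    rw [← Finset.HasAntidiagonal.mem_antidiagonal.mp hp, pow_add]
    linear_combination w (p.1 + 1) / qPoch q q p.2 * q ^ p.2 * eulerCoeff_succ_mul hq p.1

theorem sum_antidiagonal_eulerCoeff {q : ℂ} (hq : ‖q‖ < 1) (N : ℕ) :
    ∑ p ∈ antidiagonal (N + 1), eulerCoeff q p.1 / qPoch q q p.2 = 0 := by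
  have hrec (N : ℕ) := sum_antidiagonal_succ_eulerCoeff hq (fun _ => 1) N
  simp only [one_mul] at hrec
  induction N with
  | zero =>
    refine (mul_eq_zero.mp ((hrec 0).trans ?_)).resolve_right (one_sub_pow_succ_ne_zero hq 0)
    simp
  | succ N ih =>
    refine (mul_eq_zero.mp ((hrec (N + 1)).trans ?_)).resolve_right
      (one_sub_pow_succ_ne_zero hq (N + 1))
    rw [ih]
    simp

/-- The derivative at `z = 1` of the finite `q`-binomial theorem for `(z;q)_{N+1}`. -/
theorem sum_antidiagonal_natCast_mul_eulerCoeff {q : ℂ} (hq : ‖q‖ < 1) (N : ℕ) :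
    ∑ p ∈ antidiagonal (N + 1), (p.1 : ℂ) * (eulerCoeff q p.1 / qPoch q q p.2) =
      -1 / (1 - q ^ (N + 1)) := by
  have hrec (N : ℕ) := sum_antidiagonal_succ_eulerCoeff hq (fun n => (n : ℂ)) N
  simp only [Nat.cast_add, Nat.cast_one, add_mul, one_mul, Finset.sum_add_distrib] at hrec
  rw [eq_div_iff (one_sub_pow_succ_ne_zero hq N)]
  induction N with
  | zero => rw [hrec]; simp [eulerCoeff_zero, qPoch]
  | succ N ih =>
    rw [hrec, sum_antidiagonal_eulerCoeff hq]
    linear_combination ih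

theorem summable_natCast_mul_pow_sq_div_qPoch {q : ℂ} (hq : ‖q‖ < 1) (a : ℂ) :
    Summable fun n : ℕ => (n * a ^ n * q ^ n ^ 2) / qPoch q q n := by
  refine Summable.of_norm_bounded (summable_eulerCoeff_mul_pow hq (2 * a)).norm fun n => ?_
  have h1 : (n : ℝ) ≤ 2 ^ n := by exact_mod_cast Nat.lt_two_pow_self.le
  have h2 : ‖q‖ ^ n ^ 2 ≤ ‖q‖ ^ n.choose 2 := by
    refine pow_le_pow_of_le_one (norm_nonneg q) hq.le ?_
    rw [Nat.choose_two_right, sq]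
    exact (Nat.div_le_self _ _).trans (Nat.mul_le_mul_left n (Nat.sub_le n 1))
  simp only [eulerCoeff, norm_mul, norm_div, norm_pow, norm_neg, norm_one, one_pow, one_mul,
    mul_pow, Complex.norm_natCast, Complex.norm_ofNat]
  calc (n : ℝ) * ‖a‖ ^ n * ‖q‖ ^ n ^ 2 / ‖qPoch q q n‖
      ≤ 2 ^ n * ‖a‖ ^ n * ‖q‖ ^ n.choose 2 / ‖qPoch q q n‖ := by gcongr
    _ = ‖q‖ ^ n.choose 2 / ‖qPoch q q n‖ * (2 ^ n * ‖a‖ ^ n) := by ring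

theorem sq_add_choose_two_add (n k : ℕ) :
    n ^ 2 + (k.choose 2 + (n + 1) * k) = (n + k + 1).choose 2 + n.choose 2 := by
  have h (m : ℕ) : (m.choose 2 : ℚ) = m * (m - 1) / 2 := Nat.cast_choose_two ℚ m
  have : ((n ^ 2 + (k.choose 2 + (n + 1) * k) : ℕ) : ℚ) =
      ((n + k + 1).choose 2 + n.choose 2 : ℕ) := by
    push_cast [h]
    ring
  exact_mod_cast this

theorem stmt11 (q a : ℂ) (hq : ‖q‖ < 1) (ha : ∀ n : ℕ, 1 - a * q ^ (n + 1) ≠ 0) :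
    qPochInf q (a * q) *
        ∑' n : ℕ, ((n + 1 : ℂ) * a ^ (n + 1) * q ^ ((n + 1) ^ 2)) /
          (qPoch q q (n + 1) * qPoch q (a * q) (n + 1))
      = ∑' n : ℕ, ((-1 : ℂ) ^ n * a ^ (n + 1) * q ^ ((n + 1) * (n + 2) / 2)) /
          (1 - q ^ (n + 1)) := by
  set u : ℕ → ℂ := fun n => (n * a ^ n * q ^ n ^ 2) / qPoch q q n with hu
  set F : ℕ × ℕ → ℂ := fun p => u p.1 * (eulerCoeff q p.2 * (a * q * q ^ p.1) ^ p.2) with hF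
  have hu0 : u 0 = 0 := by simp [hu]
  have hFs : Summable F := by
    refine Summable.of_norm_bounded ((summable_natCast_mul_pow_sq_div_qPoch hq a).norm.mul_of_nonneg
      (summable_eulerCoeff_mul_pow hq a).norm (fun _ => norm_nonneg _) fun _ => norm_nonneg _) ?_
    rintro ⟨n, k⟩
    simp only [hF, hu]
    rw [norm_mul, norm_mul (eulerCoeff q k), norm_mul (eulerCoeff q k), norm_pow, norm_pow,
      mul_assoc a, ← pow_succ', norm_mul a, norm_pow]
    gcongr
    exact mul_le_of_le_one_right (norm_nonneg a) (pow_le_one₀ (norm_nonneg q) hq.le)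
  have hrow (n : ℕ) : ∑' k, F (n, k) = qPochInf q (a * q) * (u n / qPoch q (a * q) n) := by
    have hne : qPoch q (a * q) n ≠ 0 := Finset.prod_ne_zero_iff.mpr fun k _ => by
      rw [mul_assoc, ← pow_succ']
      exact ha k
    rw [qPochInf_eq_tsum hq, tsum_eulerCoeff_eq_qPoch_mul hq (a * q) n]
    simp only [hF, tsum_mul_left]
    field_simp
  have hdiag (N : ℕ) : ∑ p ∈ antidiagonal N, F p = (-1) ^ N * a ^ N * q ^ (N + 1).choose 2 *
      ∑ p ∈ antidiagonal N, (p.1 : ℂ) * (eulerCoeff q p.1 / qPoch q q p.2) := by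
    rw [Finset.mul_sum]
    refine Finset.sum_congr rfl ?_
    rintro ⟨n, k⟩ hp
    obtain rfl : n + k = N := Finset.HasAntidiagonal.mem_antidiagonal.mp hp
    have hexp : q ^ n ^ 2 * (q ^ k.choose 2 * (q ^ (n + 1)) ^ k) =
        q ^ (n + k + 1).choose 2 * q ^ n.choose 2 := by
      rw [← pow_mul, ← pow_add, ← pow_add, ← pow_add, sq_add_choose_two_add]
    have hsign : (-1 : ℂ) ^ n * (-1) ^ n = 1 := by rw [← mul_pow]; simp
    simp only [hF, hu, eulerCoeff]
    rw [mul_assoc a, ← pow_succ', mul_pow, pow_add (-1 : ℂ), pow_add a]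
    calc _ = n * a ^ n * a ^ k * (-1) ^ k / (qPoch q q n * qPoch q q k) *
          (q ^ n ^ 2 * (q ^ k.choose 2 * (q ^ (n + 1)) ^ k)) := by ring
      _ = n * a ^ n * a ^ k * (-1) ^ k / (qPoch q q n * qPoch q q k) *
          (q ^ (n + k + 1).choose 2 * q ^ n.choose 2) * ((-1 : ℂ) ^ n * (-1) ^ n) := by
        rw [hexp, hsign, mul_one]
      _ = _ := by ring
  have hdiags : HasSum (fun N => ∑ p ∈ antidiagonal N, F p) (∑' p, F p) := by
    have h := (Finset.HasAntidiagonal.sigmaAntidiagonalEquivProd.hasSum_iff.mpr hFs.hasSum).sigma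
      fun N => (hasSum_fintype _)
    simpa [Finset.sum_attach _ F] using h
  have hrows : HasSum (fun n => ∑' k, F (n, k)) (∑' p, F p) := hFs.hasSum.prod_fiberwise fun n =>
    (hFs.prod_factor n).hasSum
  have hL := hrows.tsum_eq
  have hR := hdiags.tsum_eq
  rw [hrows.summable.tsum_eq_zero_add] at hL
  rw [hdiags.summable.tsum_eq_zero_add] at hR
  simp only [hrow, hu0, zero_div, mul_zero, zero_add, tsum_mul_left] at hL
  simp only [hdiag, sum_antidiagonal_natCast_mul_eulerCoeff hq] at hR
  simp only [Finset.HasAntidiagonal.antidiagonal_zero, Finset.sum_singleton, Nat.cast_zero, zero_mul, mul_zero,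
    zero_add] at hR
  calc _ = ∑' p, F p := by
        rw [← hL]
        simp only [hu, div_div, Nat.cast_add, Nat.cast_one]
    _ = _ := by
        rw [← hR]
        refine tsum_congr fun n => ?_
        rw [Nat.choose_two_right, Nat.add_sub_cancel, mul_comm (n + 1 + 1), pow_succ (-1 : ℂ)]
        ring
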